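/- Let d ≥ 3, let w be a doubly infinite transient trajectory in ℤ^d, let n₀ < … < n_J be cut-times of w with n_{j+1} − n_j ≥ 2 for j = 0,…,J−1, and assume diam(𝒰_j) ≤ h for all j, for some integer h ≥ 2. Then fill({w(l) : n₀ < l < n_J}) = (⋃_{j=0}^{J−1} fill(𝒰_j)) ∪ {w(n_j) : j = 1,…,J−1}. -/

import Mathlib

/-- Points of `ℤ^d`. -/
abbrev Pt (d : ℕ) := Fin d → ℤ

namespace RI

variable {d : ℕ}

/-- `l¹` distance between two points (ℕ-valued). -/
def n1 (x y : Pt d) : ℕ := ∑ j, (x j - y j).natAbs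

/-- `l∞` distance between two points (ℕ-valued). -/
def ninf (x y : Pt d) : ℕ := Finset.univ.sup fun j => (x j - y j).natAbs

/-- nearest-neighbor adjacency: `‖x - y‖₁ = 1` -/
def adj (x y : Pt d) : Prop := n1 x y = 1

/-- `*`-adjacency: `‖x - y‖_∞ = 1` -/
def adjStar (x y : Pt d) : Prop := ninf x y = 1

/-- `τ` is a nearest-neighbor path of length `N`. -/
def IsPath (τ : ℕ → Pt d) (N : ℕ) : Prop := ∀ l < N, adj (τ l) (τ (l + 1))

/-- the range of a path of length `N` -/
def pathRange (τ : ℕ → Pt d) (N : ℕ) : Set (Pt d) := τ '' {l | l ≤ N}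

/-- `x` and `y` are joined by a nearest-neighbor path all of whose points lie in `U`. -/
def ConnIn (U : Set (Pt d)) (x y : Pt d) : Prop :=
  ∃ τ N, IsPath τ N ∧ τ 0 = x ∧ τ N = y ∧ ∀ l ≤ N, τ l ∈ U

/-- a set is connected: any two of its points are joined by a path inside it -/
def ConnSet (A : Set (Pt d)) : Prop := ∀ x ∈ A, ∀ y ∈ A, ConnIn A x y

/-- the connected component of `U` containing `x` -/
def comp (U : Set (Pt d)) (x : Pt d) : Set (Pt d) := {y | ConnIn U x y}

/-- the (outer) boundary `∂K` -/
def bd (K : Set (Pt d)) : Set (Pt d) := {x | x ∉ K ∧ ∃ y ∈ K, adj x y}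

/-- the `*`-boundary `∂*K` -/
def bdStar (K : Set (Pt d)) : Set (Pt d) := {x | x ∉ K ∧ ∃ y ∈ K, adjStar x y}

/-- the interior boundary `∂_int K` -/
def intBd (K : Set (Pt d)) : Set (Pt d) := {x | x ∈ K ∧ ∃ y, y ∉ K ∧ adj x y}

/-- the `l∞` diameter of a set, valued in `ℕ∞` -/
noncomputable def diam (K : Set (Pt d)) : ℕ∞ := ⨆ x ∈ K, ⨆ y ∈ K, (ninf x y : ℕ∞)

/-- the `l¹` distance between `K` and `K'` exceeds `1` -/
def far1 (K K' : Set (Pt d)) : Prop := ∀ x ∈ K, ∀ y ∈ K', 1 < n1 x y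

/-- the `l∞` distance between `K` and `K'` exceeds `1` -/
def farInf (K K' : Set (Pt d)) : Prop := ∀ x ∈ K, ∀ y ∈ K', 1 < ninf x y

/-- `d_∞(K, K') ≤ r` -/
def dInfLE (K K' : Set (Pt d)) (r : ℕ) : Prop := ∃ x ∈ K, ∃ y ∈ K', ninf x y ≤ r

/-- `fill A`: the set of points every connected set around which inside `Aᶜ` is finite;
for `d ≥ 2` and finite `A` this is exactly the complement of the unique infinite
connected component of `Aᶜ`. -/
def fill (A : Set (Pt d)) : Set (Pt d) :=
  {z | ∀ S : Set (Pt d), z ∈ S → S ⊆ Aᶜ → ConnSet S → S.Finite}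

/-- `A₁` and `A₂` are separated by `𝒰` in `B`: `d(A₁,A₂) > 1` and every path in `B`
joining `∂A₁` to `∂A₂` meets `𝒰`. -/
def SeparatedBy (A₁ A₂ 𝒰 B : Set (Pt d)) : Prop :=
  far1 A₁ A₂ ∧
  ∀ τ N, IsPath τ N → (∀ l ≤ N, τ l ∈ B) → τ 0 ∈ bd A₁ → τ N ∈ bd A₂ →
    ∃ l ≤ N, τ l ∈ 𝒰

/-- the scales `L_κ = L₀ (80 L)^κ` -/
def Lscale (L L₀ κ : ℕ) : ℕ := L₀ * (80 * L) ^ κ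

/-- the box `C_{(κ,i)} = (i L_κ + [0, L_κ)^d) ∩ ℤ^d` -/
def boxC (L L₀ κ : ℕ) (i : Pt d) : Set (Pt d) :=
  {x | ∀ j, i j * (Lscale L L₀ κ : ℤ) ≤ x j ∧
    x j < i j * (Lscale L L₀ κ : ℤ) + (Lscale L L₀ κ : ℤ)}

/-- the neighborhood `C_{(κ,i)}^l = ⋃_{‖j‖_∞ < l} C_{(κ, i+j)}` -/
def boxCl (L L₀ κ : ℕ) (i : Pt d) (l : ℕ) : Set (Pt d) :=
  ⋃ j ∈ {j : Pt d | ∀ t, (j t).natAbs < l}, boxC L L₀ κ (i + j)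

/-- the separation event `χ_{(κ,i)}(𝒰) = 1`: there are connected sets
`A₁, A₂ ⊆ C_{(κ,i)}^2` of diameter at least `L_κ / 2` separated by `𝒰` in `C_{(κ,i)}^3` -/
def chi (L L₀ κ : ℕ) (i : Pt d) (𝒰 : Set (Pt d)) : Prop :=
  ∃ A₁ A₂ : Set (Pt d), A₁ ⊆ boxCl L L₀ κ i 2 ∧ A₂ ⊆ boxCl L L₀ κ i 2 ∧
    ConnSet A₁ ∧ ConnSet A₂ ∧
    (Lscale L L₀ κ : ℕ∞) ≤ 2 * diam A₁ ∧ (Lscale L L₀ κ : ℕ∞) ≤ 2 * diam A₂ ∧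
    SeparatedBy A₁ A₂ 𝒰 (boxCl L L₀ κ i 3)

/-- the centered boxes `C^l = [-(l-1)L₀, l L₀)^d ∩ ℤ^d` -/
def boxCen (L₀ l : ℕ) : Set (Pt d) :=
  {x | ∀ j, -(((l : ℤ) - 1) * (L₀ : ℤ)) ≤ x j ∧ x j < (l : ℤ) * (L₀ : ℤ)}

/-- the separation event `χ(𝒰) = 1` for the centered boxes -/
def chi0 (L₀ : ℕ) (𝒰 : Set (Pt d)) : Prop :=
  ∃ A₁ A₂ : Set (Pt d), A₁ ⊆ boxCen L₀ 2 ∧ A₂ ⊆ boxCen L₀ 2 ∧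
    ConnSet A₁ ∧ ConnSet A₂ ∧
    (L₀ : ℕ∞) ≤ 2 * diam A₁ ∧ (L₀ : ℕ∞) ≤ 2 * diam A₂ ∧
    SeparatedBy A₁ A₂ 𝒰 (boxCen L₀ 3)

/-- `A` is `h`-avoidable in `C`: every path in `C` with endpoints outside `A` can be
modified, within `l∞` distance `h` of its range and through `Range(τ) ∪ ∂*A`,
into a path with the same endpoints avoiding `A`. -/
def Avoidable (h : ℝ) (A C : Set (Pt d)) : Prop :=
  ∀ τ N, IsPath τ N → (∀ l ≤ N, τ l ∈ C) → τ 0 ∉ A → τ N ∉ A →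
    ∃ τ' N', IsPath τ' N' ∧ τ' 0 = τ 0 ∧ τ' N' = τ N ∧
      (∀ l ≤ N', τ' l ∉ A) ∧
      (∀ l ≤ N', (∃ k ≤ N, (ninf (τ' l) (τ k) : ℝ) ≤ h) ∧
        (τ' l ∈ pathRange τ N ∨ τ' l ∈ bdStar A))

/-- a doubly infinite transient nearest-neighbor trajectory -/
def IsTraj (w : ℤ → Pt d) : Prop :=
  (∀ l : ℤ, adj (w l) (w (l + 1))) ∧
  Filter.Tendsto (fun l : ℤ => n1 (w l) 0) Filter.cofinite Filter.atTop

/-- `k` is a cut-time of `w`: `d_∞({w(l) : l < k}, {w(l) : l > k}) > 1` -/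
def CutTime (w : ℤ → Pt d) (k : ℤ) : Prop :=
  ∀ l, l < k → ∀ l', k < l' → 1 < ninf (w l) (w l')

/-- the `j`-th sausage `𝒰_j = {w(l) : n_j < l < n_{j+1}}` -/
def sausage (w : ℤ → Pt d) (n : ℕ → ℤ) (j : ℕ) : Set (Pt d) :=
  w '' {l | n j < l ∧ l < n (j + 1)}

/-- boxes: products of integer intervals -/
def IsBox (B : Set (Pt d)) : Prop :=
  ∃ a b : Pt d, B = {x | ∀ j, a j ≤ x j ∧ x j ≤ b j}

/-- the smallest box containing `K` -/
def sbox (K : Set (Pt d)) : Set (Pt d) := ⋂₀ {B | IsBox B ∧ K ⊆ B}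

/-- the closed `l∞` ball `B(x, r)` -/
def ball (x : Pt d) (r : ℕ) : Set (Pt d) := {y | ninf x y ≤ r}

/-- a skeleton: a set of indices at the finest scale satisfying the Wiener-type
spacing conditions -/
def IsSkeleton (L L₀ : ℕ) (M : Finset (Pt d)) : Prop :=
  ∀ m₀ ∈ M,
    (∀ h : ℕ,
      {m : Pt d | m ∈ M ∧
        dInfLE (boxC L L₀ 0 m₀) (boxC L L₀ 0 m) (L * Lscale L L₀ (h + 1)) ∧
        ¬ dInfLE (boxC L L₀ 0 m₀) (boxC L L₀ 0 m) (L * Lscale L L₀ h)}.ncard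
        ≤ 2 ^ (h + 1)) ∧
    ∀ m ∈ M, m ≠ m₀ → ¬ dInfLE (boxC L L₀ 0 m₀) (boxC L L₀ 0 m) (L * Lscale L L₀ 0)

/-! ### Connectivity inside a set -/

theorem connIn_iff {U : Set (Pt d)} {x y : Pt d} :
    ConnIn U x y ↔
      x ∈ U ∧ Relation.ReflTransGen (fun a b => adj a b ∧ a ∈ U ∧ b ∈ U) x y := by
  constructor
  · rintro ⟨τ, N, hτ, rfl, rfl, hU⟩
    refine ⟨hU 0 (Nat.zero_le _), ?_⟩
    have key : ∀ l ≤ N,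
        Relation.ReflTransGen (fun a b => adj a b ∧ a ∈ U ∧ b ∈ U) (τ 0) (τ l) := by
      intro l
      induction l with
      | zero => exact fun _ => .refl
      | succ l ih =>
        exact fun hl => (ih (by omega)).tail ⟨hτ l (by omega), hU l (by omega), hU _ hl⟩
    exact key N le_rfl
  · rintro ⟨hx, hxy⟩
    induction hxy with
    | refl => exact ⟨fun _ => x, 0, fun l hl => absurd hl (by omega), rfl, rfl, fun _ _ => hx⟩
    | @tail b c _ hbc ih =>
      obtain ⟨τ, N, hτ, h0, hN, hU⟩ := ih
      refine ⟨fun l => if l ≤ N then τ l else c, N + 1, ?_, by simpa using h0, by simp, ?_⟩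
      · intro l hl
        rcases Nat.lt_or_ge l N with h | h
        · have h1 : l ≤ N := h.le
          have h2 : l + 1 ≤ N := h
          simpa [h1, h2] using hτ l h
        · obtain rfl : l = N := by omega
          simpa [hN] using hbc.1
      · intro l hl
        by_cases h : l ≤ N
        · simpa [h] using hU l h
        · simpa [h] using hbc.2.2

theorem adj_comm {x y : Pt d} : adj x y ↔ adj y x := by
  unfold adj n1
  simp only [← Int.natAbs_neg (x _ - y _), neg_sub]

namespace ConnIn

variable {U V : Set (Pt d)} {x y z : Pt d}

theorem refl (hx : x ∈ U) : ConnIn U x x := connIn_iff.2 ⟨hx, .refl⟩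

theorem left_mem (h : ConnIn U x y) : x ∈ U := (connIn_iff.1 h).1

theorem trans (h : ConnIn U x y) (h' : ConnIn U y z) : ConnIn U x z :=
  connIn_iff.2 ⟨h.left_mem, (connIn_iff.1 h).2.trans (connIn_iff.1 h').2⟩

theorem single (h : adj x y) (hx : x ∈ U) (hy : y ∈ U) : ConnIn U x y :=
  connIn_iff.2 ⟨hx, .single ⟨h, hx, hy⟩⟩

theorem right_mem (h : ConnIn U x y) : y ∈ U := by
  obtain ⟨τ, N, -, -, rfl, hU⟩ := h
  exact hU N le_rfl

theorem symm (h : ConnIn U x y) : ConnIn U y x := by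
  refine connIn_iff.2 ⟨h.right_mem, ?_⟩
  have hs : Std.Symm (fun a b : Pt d => adj a b ∧ a ∈ U ∧ b ∈ U) :=
    ⟨fun a b hab => ⟨adj_comm.1 hab.1, hab.2.2, hab.2.1⟩⟩
  exact Std.Symm.symm _ _ (connIn_iff.1 h).2

theorem mono (hUV : U ⊆ V) (h : ConnIn U x y) : ConnIn V x y := by
  obtain ⟨τ, N, hτ, h0, hN, hU⟩ := h
  exact ⟨τ, N, hτ, h0, hN, fun l hl => hUV (hU l hl)⟩

/-- Induction along a path in `U` starting at `x`. -/
theorem induct {P : Pt d → Prop} (h : ConnIn U x y) (h0 : P x)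
    (hs : ∀ a b, adj a b → a ∈ U → b ∈ U → P a → P b) : P y := by
  have h' := (connIn_iff.1 h).2
  clear h
  induction h' with
  | refl => exact h0
  | tail _ hbc ih => exact hs _ _ hbc.1 hbc.2.1 hbc.2.2 ih

end ConnIn

theorem connSet_comp (U : Set (Pt d)) (z : Pt d) : ConnSet (comp U z) := by
  have key : ∀ y ∈ comp U z, ConnIn (comp U z) z y := by
    intro y hy
    have hz : ConnIn U z z := .refl (ConnIn.left_mem hy)
    refine (ConnIn.induct (P := fun y => ConnIn U z y ∧ ConnIn (comp U z) z y) hy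
      ⟨hz, .refl hz⟩ ?_).2
    rintro a b hab ha hb ⟨h1, h2⟩
    have h3 : ConnIn U z b := h1.trans (.single hab ha hb)
    exact ⟨h3, h2.trans (.single hab h1 h3)⟩
  exact fun x hx y hy => (key x hx).symm.trans (key y hy)

/-! ### Unit steps -/

theorem adj_add_single (x : Pt d) (i : Fin d) {s : ℤ} (hs : s.natAbs = 1) :
    adj x (x + Pi.single i s) := by
  unfold adj n1
  rw [Finset.sum_eq_single i]
  · simp [hs]
  · intro j _ hj
    simp [hj]
  · simp

theorem adj_iff {x y : Pt d} :
    adj x y ↔ ∃ i, ∃ s : ℤ, s.natAbs = 1 ∧ y = x + Pi.single i s := by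
  constructor
  · intro h
    unfold adj n1 at h
    obtain ⟨i, -, hi⟩ : ∃ i ∈ Finset.univ, (x i - y i).natAbs ≠ 0 := by
      by_contra! hc
      rw [Finset.sum_eq_zero hc] at h
      omega
    rw [← Finset.add_sum_erase _ _ (Finset.mem_univ i)] at h
    refine ⟨i, y i - x i, by omega, ?_⟩
    have hz : ∑ j ∈ Finset.univ.erase i, (x j - y j).natAbs = 0 := by omega
    ext j
    by_cases hj : j = i
    · subst hj; simp
    · have := (Finset.sum_eq_zero_iff.1 hz) j (by simp [hj])
      simp [hj]
      omega
  · rintro ⟨i, s, hs, rfl⟩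
    exact adj_add_single x i hs

theorem ninf_le_iff {x y : Pt d} {r : ℕ} : ninf x y ≤ r ↔ ∀ j, (x j - y j).natAbs ≤ r := by
  simp [ninf]

/-- A function invariant under unit steps inside `U` is constant along paths in `U`. -/
theorem ConnIn.eq_of_step {α : Type*} {U : Set (Pt d)} {x y : Pt d} (h : ConnIn U x y)
    (φ : Pt d → α) (hφ : ∀ a i, a ∈ U → a + Pi.single i 1 ∈ U → φ (a + Pi.single i 1) = φ a) :
    φ y = φ x := by
  refine h.induct (P := fun y => φ y = φ x) rfl ?_
  intro a b hab ha hb hP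
  obtain ⟨i, s, hs, rfl⟩ := adj_iff.1 hab
  obtain rfl | rfl : s = 1 ∨ s = -1 := by omega
  · rw [hφ a i ha hb, hP]
  · have h1 : a + Pi.single i (-1) + Pi.single i 1 = a := by
      rw [add_assoc, ← Pi.single_add]; simp
    rw [← hP, ← hφ _ i hb (by rwa [h1]), h1]

/-! ### A discrete Poincaré lemma -/

theorem exists_int_primitive (f : ℤ → ℤ) : ∃ g : ℤ → ℤ, ∀ t, g (t + 1) - g t = f t := by
  refine ⟨fun t => ∑ k ∈ Finset.Ico 0 t, f k - ∑ k ∈ Finset.Ico t 0, f k, fun t => ?_⟩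
  rcases le_or_gt 0 t with ht | ht
  · have h1 : Finset.Ico (t + 1) 0 = ∅ := Finset.Ico_eq_empty (by omega)
    have h2 : Finset.Ico t 0 = ∅ := Finset.Ico_eq_empty (by omega)
    have h3 : Finset.Ico 0 (t + 1) = insert t (Finset.Ico 0 t) := by
      ext k; simp only [Finset.mem_Ico, Finset.mem_insert]; omega
    simp only [h1, h2, h3]
    rw [Finset.sum_insert (by simp)]
    simp
  · have h1 : Finset.Ico 0 (t + 1) = ∅ := Finset.Ico_eq_empty (by omega)
    have h2 : Finset.Ico 0 t = ∅ := Finset.Ico_eq_empty (by omega)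
    have h3 : Finset.Ico t 0 = insert t (Finset.Ico (t + 1) 0) := by
      ext k; simp only [Finset.mem_Ico, Finset.mem_insert]; omega
    simp only [h1, h2, h3]
    rw [Finset.sum_insert (by simp)]
    simp

/-- A function on the directed edges of `ℤ^d` whose sum around every unit square vanishes
is a gradient. -/
theorem exists_potential (F : Pt d → Fin d → ℤ)
    (hF : ∀ x i j, F x i + F (x + Pi.single i 1) j = F x j + F (x + Pi.single j 1) i) :
    ∃ g : Pt d → ℤ, ∀ x i, g (x + Pi.single i 1) - g x = F x i := by
  suffices key : ∀ s : Finset (Fin d),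
      ∃ g : Pt d → ℤ, ∀ i ∈ s, ∀ x, g (x + Pi.single i 1) - g x = F x i by
    obtain ⟨g, hg⟩ := key Finset.univ
    exact ⟨g, fun x i => hg i (Finset.mem_univ i) x⟩
  intro s
  induction s using Finset.induction_on with
  | empty => exact ⟨0, by simp⟩
  | insert j s hj ih =>
    obtain ⟨g, hg⟩ := ih
    choose prim hprim using exists_int_primitive
    set G : Pt d → ℤ := fun x => F x j - (g (x + Pi.single j 1) - g x) with hG
    have hinv : ∀ i ∈ s, ∀ x, G (x + Pi.single i 1) = G x := by
      intro i hi x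
      have h1 := hg i hi x
      have h2 := hg i hi (x + Pi.single j 1)
      have h3 := hF x i j
      rw [add_right_comm] at h2
      simp only [hG]
      linarith
    refine ⟨fun x => g x + prim (fun t => G (Function.update x j t)) (x j), ?_⟩
    intro i hi x
    rcases Finset.mem_insert.1 hi with rfl | hi
    · have h1 : ∀ t, Function.update (x + Pi.single i 1) i t = Function.update x i t := by
        intro t; ext k
        by_cases hk : k = i
        · subst hk; simp
        · simp [hk]
      have h2 := hprim (fun t => G (Function.update x i t)) (x i)
      simp only [Function.update_eq_self] at h2
      simp only [h1, Pi.add_apply, Pi.single_eq_same]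
      have h3 : G x = F x i - (g (x + Pi.single i 1) - g x) := rfl
      linarith
    · have hij : j ≠ i := fun h => hj (h ▸ hi)
      have h1 : ∀ t, G (Function.update (x + Pi.single i 1) j t) = G (Function.update x j t) := by
        intro t
        rw [← hinv i hi (Function.update x j t)]
        congr 1
        ext k
        by_cases hk : k = j
        · subst hk; simp [hij]
        · simp [hk]
      have h2 := hg i hi x
      simp only [h1, Pi.add_apply, Pi.single_eq_of_ne hij, add_zero]
      linarith

/-! ### Separation by two distant sets -/

/-- If neither of two sets at `l∞` distance greater than `1` separates `z` from `z'`,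
then neither does their union. -/
theorem connIn_compl_union {K₁ K₂ : Set (Pt d)} (hfar : farInf K₁ K₂) {z z' : Pt d}
    (h₁ : ConnIn K₁ᶜ z z') (h₂ : ConnIn K₂ᶜ z z') : ConnIn (K₁ ∪ K₂)ᶜ z z' := by
  classical
  have hdisj : ∀ x ∈ K₁, ∀ y, (∀ k, (x k - y k).natAbs ≤ 1) → y ∈ K₂ᶜ :=
    fun x hx y hxy hy => absurd (hfar x hx y hy) (not_lt.2 (ninf_le_iff.2 hxy))
  set C : Set (Pt d) := comp (K₁ ∪ K₂)ᶜ z with hC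
  set a : Pt d → ℤ := fun y => if y ∈ C then 1 else 0 with ha
  set F : Pt d → Fin d → ℤ := fun x i =>
    if x ∈ K₁ᶜ ∧ x + Pi.single i 1 ∈ K₁ᶜ then a (x + Pi.single i 1) - a x else 0 with hFdef
  have hF₁ : ∀ x i, x ∈ K₁ᶜ → x + Pi.single i 1 ∈ K₁ᶜ →
      F x i = a (x + Pi.single i 1) - a x := fun x i hx hy => if_pos ⟨hx, hy⟩
  have hF₂ : ∀ x i, x ∈ K₂ᶜ → x + Pi.single i 1 ∈ K₂ᶜ → F x i = 0 := by
    intro x i hx hy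
    by_cases h : x ∈ K₁ᶜ ∧ x + Pi.single i 1 ∈ K₁ᶜ
    · rw [hF₁ x i h.1 h.2]
      have hx' : x ∈ (K₁ ∪ K₂)ᶜ := fun hh => hh.elim h.1 hx
      have hy' : x + Pi.single i 1 ∈ (K₁ ∪ K₂)ᶜ := fun hh => hh.elim h.2 hy
      have hs := ConnIn.single (adj_add_single x i (s := 1) rfl) hx' hy'
      have : x + Pi.single i 1 ∈ C ↔ x ∈ C :=
        ⟨fun hc => ConnIn.trans hc hs.symm, fun hc => ConnIn.trans hc hs⟩
      simp [ha, this]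
    · exact if_neg h
  have hclosed : ∀ x i j,
      F x i + F (x + Pi.single i 1) j = F x j + F (x + Pi.single j 1) i := by
    intro x i j
    by_cases hij : i = j
    · subst hij; rfl
    have hcomm : x + Pi.single j 1 + Pi.single i 1 = x + Pi.single i 1 + Pi.single j 1 :=
      add_right_comm _ _ _
    by_cases hall : x ∈ K₁ᶜ ∧ x + Pi.single i 1 ∈ K₁ᶜ ∧ x + Pi.single j 1 ∈ K₁ᶜ ∧
        x + Pi.single i 1 + Pi.single j 1 ∈ K₁ᶜ
    · obtain ⟨p, q, r, s⟩ := hall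
      rw [hF₁ x i p q, hF₁ _ j q s, hF₁ x j p r, hF₁ _ i r (by rwa [hcomm]), hcomm]
      ring
    · obtain ⟨v, hv, hvx⟩ : ∃ v ∈ K₁, ∀ k, (x k ≤ v k ∧ v k ≤ x k + 1) ∧
          (k ≠ i → k ≠ j → v k = x k) := by
        have hij' : j ≠ i := fun h => hij h.symm
        simp only [Set.mem_compl_iff, not_and_or, not_not] at hall
        rcases hall with h | h | h | h <;> refine ⟨_, h, fun k => ?_⟩ <;>
          by_cases hki : k = i <;> by_cases hkj : k = j <;> simp_all
      have hmem : ∀ y : Pt d, (∀ k, (x k ≤ y k ∧ y k ≤ x k + 1)) → y ∈ K₂ᶜ := by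
        intro y hy
        refine hdisj v hv y fun k => ?_
        have := (hvx k).1
        have := hy k
        omega
      have p : x ∈ K₂ᶜ := hmem _ fun k => by omega
      have q : ∀ i, x + Pi.single i 1 ∈ K₂ᶜ := fun i => hmem _ fun k => by
        by_cases hk : k = i <;> simp [hk]
      have s : x + Pi.single i 1 + Pi.single j 1 ∈ K₂ᶜ := hmem _ fun k => by
        by_cases hki : k = i <;> by_cases hkj : k = j <;> simp_all
      rw [hF₂ x i p (q i), hF₂ _ j (q i) s, hF₂ x j p (q j), hF₂ _ i (q j) (by rwa [hcomm])]
  obtain ⟨g, hg⟩ := exists_potential F hclosed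
  have e₂ : g z' = g z := h₂.eq_of_step g fun x i hx hy => by
    have := hg x i
    rw [hF₂ x i hx hy] at this
    omega
  have e₁ : g z' - a z' = g z - a z := h₁.eq_of_step (fun x => g x - a x) fun x i hx hy => by
    have := hg x i
    rw [hF₁ x i hx hy] at this
    omega
  have hz : z ∈ C := ConnIn.refl fun hh => hh.elim h₁.left_mem h₂.left_mem
  have haz : a z' = 1 := by
    have : a z = 1 := if_pos hz
    omega
  by_contra hn
  have : a z' = 0 := if_neg hn
  omega

/-- Paths can be rerouted around a point `x` one of whose axes is blocked on both sides by
two sets at `l∞` distance greater than `1`. -/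
theorem connIn_compl_insert (hd : 3 ≤ d) {K₁ K₂ : Set (Pt d)} (hfar : farInf K₁ K₂)
    {x a b : Pt d} (hxa : adj x a) (hxb : adj x b) (ha : a ∈ K₁) (hb : b ∈ K₂) {z z' : Pt d}
    (hz : z ≠ x) (hz' : z' ≠ x) (h : ConnIn (K₁ ∪ K₂)ᶜ z z') :
    ConnIn (insert x (K₁ ∪ K₂))ᶜ z z' := by
  obtain ⟨i, s, hs, rfl⟩ := adj_iff.1 hxa
  obtain ⟨i', s', hs', rfl⟩ := adj_iff.1 hxb
  have hab := hfar _ ha _ hb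
  obtain ⟨rfl, rfl⟩ : i' = i ∧ s' = -s := by
    rw [← not_le, ninf_le_iff] at hab
    push Not at hab
    obtain ⟨k, hk⟩ := hab
    by_cases h1 : k = i <;> by_cases h2 : k = i'
    · subst h1 h2
      simp at hk
      exact ⟨rfl, by omega⟩
    all_goals
      simp [Pi.single_apply, h1, h2] at hk
      try omega
  have hring : ∀ y : Pt d, y i' = x i' → (∀ k, (y k - x k).natAbs ≤ 1) → y ≠ x →
      y ∈ (insert x (K₁ ∪ K₂))ᶜ := by
    rintro y hyi hyk hyx (hy | hy | hy)
    · exact hyx hy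
    · refine absurd (hfar _ hy _ hb) (not_lt.2 (ninf_le_iff.2 fun k => ?_))
      by_cases hk : k = i'
      · subst hk; simp [hyi]; omega
      · simpa [hk] using hyk k
    · refine absurd (hfar _ ha _ hy) (not_lt.2 (ninf_le_iff.2 fun k => ?_))
      by_cases hk : k = i'
      · subst hk; simp [hyi]; omega
      · have := hyk k
        simp [hk]
        omega
  have hmem : ∀ j (t : ℤ), j ≠ i' → t.natAbs = 1 →
      x + Pi.single j t ∈ (insert x (K₁ ∪ K₂))ᶜ := by
    intro j t hj ht
    refine hring _ (by simp [hj.symm]) (fun k => ?_) fun he => ?_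
    · by_cases hk : k = j
      · subst hk; simp [ht]
      · simp [hk]
    · have := congrFun he j
      simp at this
      omega
  have hne : ∀ j k (t u : ℤ), j ≠ i' → k ≠ i' → j ≠ k → t.natAbs = 1 → u.natAbs = 1 →
      ConnIn (insert x (K₁ ∪ K₂))ᶜ (x + Pi.single j t) (x + Pi.single k u) := by
    intro j k t u hj hk hjk ht hu
    have hm : x + Pi.single j t + Pi.single k u ∈ (insert x (K₁ ∪ K₂))ᶜ := by
      refine hring _ (by simp [hj.symm, hk.symm]) (fun l => ?_) fun he => ?_
      · by_cases hlj : l = j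
        · subst hlj; simp [hjk, ht]
        · by_cases hlk : l = k
          · subst hlk; simp [hlj, hu]
          · simp [hlj, hlk]
      · have := congrFun he j
        simp [hjk] at this
        omega
    have hlast := adj_add_single (x + Pi.single k u) j ht
    rw [add_right_comm] at hlast
    exact (ConnIn.single (adj_add_single _ k hu) (hmem j t hj ht) hm).trans
      (ConnIn.single hlast (hmem k u hk hu) hm).symm
  have hnbr : ∀ p q : Pt d, adj x p → adj x q → p ∈ (K₁ ∪ K₂)ᶜ → q ∈ (K₁ ∪ K₂)ᶜ →
      ConnIn (insert x (K₁ ∪ K₂))ᶜ p q := by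
    have haxis : ∀ j (t : ℤ), t.natAbs = 1 → x + Pi.single j t ∈ (K₁ ∪ K₂)ᶜ → j ≠ i' := by
      rintro j t ht hp rfl
      obtain rfl | rfl : t = s ∨ t = -s := by omega
      · exact hp (Or.inl ha)
      · exact hp (Or.inr hb)
    intro p q hp hq hp' hq'
    obtain ⟨j, t, ht, rfl⟩ := adj_iff.1 hp
    obtain ⟨k, u, hu, rfl⟩ := adj_iff.1 hq
    have hj := haxis j t ht hp'
    have hk := haxis k u hu hq'
    by_cases hjk : j = k
    · obtain ⟨m, hm⟩ : ∃ m, m ∉ ({i', j} : Finset (Fin d)) := by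
        by_contra! hc
        have h1 : Finset.univ ⊆ ({i', j} : Finset (Fin d)) := fun m _ => hc m
        have h2 := Finset.card_le_card h1
        have h3 := Finset.card_le_two (a := i') (b := j)
        simp only [Finset.card_univ, Fintype.card_fin] at h2
        omega
      simp only [Finset.mem_insert, Finset.mem_singleton, not_or] at hm
      exact (hne j m t 1 hj hm.1 (Ne.symm hm.2) ht rfl).trans
        (hne m k 1 u hm.1 hk (hjk ▸ hm.2) rfl hu)
    · exact hne j k t u hj hk hjk ht hu
  refine (h.induct (P := fun y => (y ≠ x → ConnIn (insert x (K₁ ∪ K₂))ᶜ z y) ∧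
    (y = x → ∀ q, adj x q → q ∈ (K₁ ∪ K₂)ᶜ → ConnIn (insert x (K₁ ∪ K₂))ᶜ z q))
    ⟨fun _ => .refl ?_, fun h => absurd h hz⟩ ?_).1 hz'
  · rintro (h' | h')
    exacts [hz h', h.left_mem h']
  · rintro p q hpq hp hq ⟨ih₁, ih₂⟩
    by_cases hpx : p = x
    · subst hpx
      refine ⟨fun _ => ih₂ rfl q hpq hq, ?_⟩
      rintro rfl
      exact ih₂ rfl
    · have hzp := ih₁ hpx
      refine ⟨fun hqx => hzp.trans (.single hpq hzp.right_mem ?_), ?_⟩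
      · rintro (h' | h')
        exacts [hqx h', hq h']
      · rintro rfl r hxr hr
        exact hzp.trans (hnbr p r (adj_comm.1 hpq) hxr hp hr)

/-! ### Filled sets -/

theorem subset_fill (A : Set (Pt d)) : A ⊆ fill A :=
  fun _ hz _ hzS hSA _ => absurd hz (hSA hzS)

theorem fill_mono {A B : Set (Pt d)} (h : A ⊆ B) : fill A ⊆ fill B :=
  fun _ hz S hzS hSB => hz S hzS (hSB.trans (Set.compl_subset_compl.2 h))

theorem connIn_update {U : Set (Pt d)} {y : Pt d} {i : Fin d}
    (hU : ∀ s, Function.update y i s ∈ U) (t : ℤ) : ConnIn U y (Function.update y i t) := by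
  have hstep : ∀ s, ConnIn U (Function.update y i s) (Function.update y i (s + 1)) := by
    intro s
    refine .single ?_ (hU _) (hU _)
    convert adj_add_single (Function.update y i s) i (s := 1) rfl using 1
    ext k
    by_cases hk : k = i
    · subst hk; simp
    · simp [hk]
  induction t using Int.inductionOn' (b := y i) with
  | zero => simpa using ConnIn.refl (hU (y i))
  | succ k _ ih => exact ih.trans (hstep k)
  | pred k _ ih =>
    have := hstep (k - 1)
    rw [sub_add_cancel] at this
    exact ih.trans this.symm

/-- The complement of a centred box is connected. -/
theorem connIn_outside (hd : 2 ≤ d) (R : ℤ) {y : Pt d} (hy : ∃ i, R < |y i|) :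
    ConnIn {x : Pt d | ∃ i, R < |x i|} y (fun _ => R + 1) := by
  obtain ⟨i, hi⟩ := hy
  have hR : R < |R + 1| := (lt_add_one R).trans_le (le_abs_self _)
  have key : ∀ s : Finset (Fin d), i ∉ s →
      ConnIn {x : Pt d | ∃ i, R < |x i|} y (fun k => if k ∈ s then R + 1 else y k) := by
    intro s
    induction s using Finset.induction_on with
    | empty => intro _; simpa using ConnIn.refl (U := {x : Pt d | ∃ i, R < |x i|}) ⟨i, hi⟩
    | insert j s hj ih =>
      intro his
      simp only [Finset.mem_insert, not_or] at his
      refine (ih his.2).trans ?_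
      convert connIn_update (i := j) ?_ (R + 1) using 1
      · ext k
        by_cases hk : k = j
        · subst hk; simp
        · simp [hk]
      · exact fun t => ⟨i, by simpa [his.1, his.2] using hi⟩
  have hlast := key (Finset.univ.erase i) (by simp)
  refine hlast.trans ?_
  obtain ⟨j, hj⟩ : ∃ j, j ≠ i := by
    have : Nontrivial (Fin d) := Fin.nontrivial_iff_two_le.2 hd
    exact exists_ne i
  convert connIn_update (i := i) ?_ (R + 1) using 1
  · ext k
    by_cases hk : k = i
    · subst hk; simp
    · simp [hk]
  · exact fun t => ⟨j, by simpa [hj] using hR⟩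

/-- A point is outside `fill A` iff it is joined in `Aᶜ` to a fixed point outside a box
containing `A`. -/
theorem notMem_fill_iff (hd : 2 ≤ d) {R : ℤ} {A : Set (Pt d)} (hA : ∀ x ∈ A, ∀ i, |x i| ≤ R)
    {z : Pt d} : z ∉ fill A ↔ ConnIn Aᶜ z (fun _ => R + 1) := by
  have hsub : {x : Pt d | ∃ i, R < |x i|} ⊆ Aᶜ := by
    rintro x ⟨i, hi⟩ hx
    exact absurd (hA x hx i) (not_le.2 hi)
  constructor
  · intro hz
    simp only [fill, Set.mem_ofPred_eq, not_forall] at hz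
    obtain ⟨S, hzS, hSA, hS, hinf⟩ := hz
    obtain ⟨y, hyS, hy⟩ : ∃ y ∈ S, ∃ i, R < |y i| := by
      by_contra! hc
      refine hinf ((Set.finite_Icc (fun _ => -R : Pt d) (fun _ => R)).subset fun y hy => ?_)
      exact ⟨fun i => (abs_le.1 (hc y hy i)).1, fun i => (abs_le.1 (hc y hy i)).2⟩
    exact ((hS z hzS y hyS).mono hSA).trans ((connIn_outside hd R hy).mono hsub)
  · intro hz hfill
    have hfin := hfill (comp Aᶜ z) (ConnIn.refl hz.left_mem) (fun y hy => hy.right_mem)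
      (connSet_comp _ _)
    have hinj : Function.Injective (fun (m : ℕ) (_ : Fin d) => |R| + 1 + (m : ℤ)) := by
      intro m m' hm
      have := congrFun hm ⟨0, by omega⟩
      simpa using this
    refine Set.infinite_of_injective_forall_mem hinj (fun m => ?_) hfin
    refine hz.trans (((connIn_outside hd R ⟨⟨0, by omega⟩, ?_⟩).mono hsub).symm)
    have h1 := le_abs_self R
    have h2 := le_abs_self (|R| + 1 + (m : ℤ))
    omega

theorem fill_empty (hd : 2 ≤ d) : fill (∅ : Set (Pt d)) = ∅ := by
  refine Set.eq_empty_of_forall_notMem fun z => ?_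
  refine (notMem_fill_iff hd (R := -1) (by simp)).2 ?_
  have hz : ∃ i, (-1 : ℤ) < |z i| := ⟨⟨0, by omega⟩, by have := abs_nonneg (z ⟨0, by omega⟩); omega⟩
  exact (connIn_outside hd (-1) hz).mono (by simp)

theorem exists_box_bound {A : Set (Pt d)} (hA : A.Finite) : ∃ R : ℤ, ∀ x ∈ A, ∀ i, |x i| ≤ R := by
  obtain ⟨R, hR⟩ := (hA.image fun x => ∑ i, |x i|).bddAbove
  refine ⟨R, fun x hx i => le_trans ?_ (hR (Set.mem_image_of_mem _ hx))⟩
  exact Finset.single_le_sum (f := fun i => |x i|) (fun _ _ => abs_nonneg _) (Finset.mem_univ i)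

/-- Filling two distant finite sets joined through a single point `x`. -/
theorem fill_insert_union (hd : 3 ≤ d) {K₁ K₂ : Set (Pt d)} (hK₁ : K₁.Finite) (hK₂ : K₂.Finite)
    (hfar : farInf K₁ K₂) {x a b : Pt d} (hxa : adj x a) (hxb : adj x b) (ha : a ∈ K₁)
    (hb : b ∈ K₂) : fill (insert x (K₁ ∪ K₂)) = insert x (fill K₁ ∪ fill K₂) := by
  have h1 : K₁ ⊆ insert x (K₁ ∪ K₂) := Set.subset_union_left.trans (Set.subset_insert _ _)
  have h2 : K₂ ⊆ insert x (K₁ ∪ K₂) := Set.subset_union_right.trans (Set.subset_insert _ _)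
  refine Set.Subset.antisymm (fun z hz => ?_) (Set.insert_subset
    (subset_fill _ (Set.mem_insert _ _)) (Set.union_subset (fill_mono h1) (fill_mono h2)))
  by_contra hn
  simp only [Set.mem_insert_iff, Set.mem_union, not_or] at hn
  obtain ⟨R, hR⟩ := exists_box_bound ((hK₁.union hK₂).insert x)
  have hd' : 2 ≤ d := by omega
  refine (notMem_fill_iff hd' hR).2 ?_ hz
  refine connIn_compl_insert hd hfar hxa hxb ha hb hn.1 (fun he => ?_) (connIn_compl_union hfar
    ((notMem_fill_iff hd' fun y hy => hR y (h1 hy)).1 hn.2.1)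
    ((notMem_fill_iff hd' fun y hy => hR y (h2 hy)).1 hn.2.2))
  have h3 := hR x (Set.mem_insert _ _) ⟨0, by omega⟩
  have h4 := le_abs_self (x ⟨0, by omega⟩)
  have h5 := congrFun he ⟨0, by omega⟩
  omega

/-- `fill({w(l) : n₀ < l < n_J})` is the union of the filled sausages
together with the cut-points `w(n_j)`, `j = 1, …, J-1`. -/
theorem statement15 (d : ℕ) (hd : 3 ≤ d) (w : ℤ → Pt d) (hw : IsTraj w)
    (J : ℕ) (n : ℕ → ℤ)
    (hgap : ∀ j < J, n j + 2 ≤ n (j + 1))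
    (hcut : ∀ j ≤ J, CutTime w (n j))
    (h : ℕ) (hh : 2 ≤ h)
    (hdiam : ∀ j < J, diam (sausage w n j) ≤ (h : ℕ∞)) :
    fill (w '' {l | n 0 < l ∧ l < n J}) =
      (⋃ j ∈ Set.Iio J, fill (sausage w n j)) ∪
      ((fun j => w (n j)) '' {j : ℕ | 1 ≤ j ∧ j < J}) := by
  clear hh hdiam
  induction J with
  | zero =>
    have : {l | n 0 < l ∧ l < n 0} = ∅ := by ext l; simp; omega
    rw [this, Set.image_empty, fill_empty (by omega)]
    simp
  | succ J ih =>
    rcases Nat.eq_zero_or_pos J with rfl | hJ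
    · have : {j : ℕ | 1 ≤ j ∧ j < 0 + 1} = ∅ := by ext j; simp; omega
      rw [this]
      simp [sausage]
    specialize ih (fun j hj => hgap j (by omega)) (fun j hj => hcut j (by omega))
    have hmono : ∀ j, 1 ≤ j → j ≤ J → n 0 + 2 ≤ n j := by
      intro j hj
      induction j, hj using Nat.le_induction with
      | base => exact fun _ => hgap 0 (by omega)
      | succ j hj ihj =>
        intro hjJ
        have := ihj (by omega)
        have := hgap j (by omega)
        omega
    have h0 := hmono J hJ le_rfl
    have h1 := hgap J (by omega)
    have hsplit : w '' {l | n 0 < l ∧ l < n (J + 1)} =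
        insert (w (n J)) (w '' {l | n 0 < l ∧ l < n J} ∪ sausage w n J) := by
      rw [sausage, ← Set.image_union, ← Set.image_insert_eq]
      congr 1
      ext l
      simp only [Set.mem_ofPred_eq, Set.mem_insert_iff, Set.mem_union]
      omega
    have hfin : ∀ p q : ℤ, (w '' {l | p < l ∧ l < q}).Finite := fun p q =>
      (Set.finite_Ioo p q).image w
    have hfar : farInf (w '' {l | n 0 < l ∧ l < n J}) (sausage w n J) := by
      rintro _ ⟨l, hl, rfl⟩ _ ⟨l', hl', rfl⟩
      exact hcut J (by omega) l hl.2 l' hl'.1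
    have hprev : adj (w (n J)) (w (n J - 1)) := by
      have := hw.1 (n J - 1)
      rw [sub_add_cancel] at this
      exact adj_comm.1 this
    have hfin' : (sausage w n J).Finite := hfin _ _
    rw [hsplit, fill_insert_union hd (hfin _ _) hfin' hfar hprev (hw.1 (n J))
      ⟨n J - 1, ⟨by omega, by omega⟩, rfl⟩ ⟨n J + 1, ⟨by omega, by omega⟩, rfl⟩, ih]
    have hI : Set.Iio (J + 1) = insert J (Set.Iio J) := by
      ext j; simp only [Set.mem_Iio, Set.mem_insert_iff]; omega
    have hP : {j : ℕ | 1 ≤ j ∧ j < J + 1} = insert J {j : ℕ | 1 ≤ j ∧ j < J} := by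
      ext j; simp; omega
    rw [hI, hP, Set.biUnion_insert, Set.image_insert_eq]
    ext z
    simp only [Set.mem_insert_iff, Set.mem_union]
    tauto

end RI
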